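/- arXiv:1909.13013 — 5 statements merged into one kernel-verified Lean document; each statement's English description precedes it below -/
import Mathlib

section
/- The congruence θ_D is a modular element of the lattice L of fully invariant congruences on the free monoid FreeMonoid ℕ: for all fully invariant congruences b, c with b ≤ c, (θ_D ⊔ b) ⊓ c = (θ_D ⊓ c) ⊔ b. (Dual rendering of the paper's Fact: the monoid variety D = var{x² ≈ x³, x²y ≈ xyx ≈ yx²} is a modular element of 𝕄𝕆ℕ; note the modular-element property is self-dual.) -/
/-- The free monoid over a countably infinite alphabet. -/
abbrev M : Type := FreeMonoid ℕ

/-- A congruence on the free monoid is fully invariant if it is stable under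
all endomorphisms of the free monoid. -/
def FullyInvariant (c : Con M) : Prop :=
  ∀ f : M →* M, ∀ u v : M, c u v → c (f u) (f v)

/-- The least fully invariant congruence containing a given set of pairs. -/
def fiClosure (S : Set (M × M)) : Con M :=
  sInf {c : Con M | FullyInvariant c ∧ ∀ p ∈ S, c p.1 p.2}

def x : M := FreeMonoid.of 0
def y : M := FreeMonoid.of 1

/-- `θ_D`, the least fully invariant congruence containing `(x^2, x^3)`,
`(x^2*y, x*y*x)` and `(x*y*x, y*x^2)`. -/
def thetaD : Con M :=
  fiClosure {(x ^ 2, x ^ 3), (x ^ 2 * y, x * y * x), (x * y * x, y * x ^ 2)}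

namespace ThetaD

open FreeMonoid

/-- The number of occurrences of the letter `a` in a word. -/
def occ (a : ℕ) (w : M) : ℕ := w.toList.count a

@[simp] lemma occ_one (a : ℕ) : occ a 1 = 0 := by simp [occ]

@[simp] lemma occ_mul (a : ℕ) (u v : M) : occ a (u * v) = occ a u + occ a v := by
  simp [occ]

@[simp] lemma occ_of (a n : ℕ) : occ a (of n) = if n = a then 1 else 0 := by
  simp [occ, toList_of, List.count_singleton]

@[simp] lemma occ_pow (a k : ℕ) (u : M) : occ a (u ^ k) = k * occ a u := by
  induction k with
  | zero => simp
  | succ k ih => rw [pow_succ, occ_mul, ih]; ring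

lemma mem_toList_iff {a : ℕ} {w : M} : a ∈ w.toList ↔ 0 < occ a w := List.count_pos_iff.symm

/-- Two words are related when their letters occur equally often, up to the cap `k`. -/
def capCon (k : ℕ) : Con M where
  r u v := ∀ a, min (occ a u) k = min (occ a v) k
  iseqv := ⟨fun _ _ => rfl, fun h a => (h a).symm, fun h h' a => (h a).trans (h' a)⟩
  mul' {_ _ _ _} h h' a := by
    have := h a
    have := h' a
    simp only [occ_mul]
    omega

lemma capCon_apply {k : ℕ} {u v : M} :
    capCon k u v ↔ ∀ a, min (occ a u) k = min (occ a v) k := Iff.rfl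

lemma capCon_two_le_one : capCon 2 ≤ capCon 1 := by
  intro u v h a
  have := h a
  omega

lemma lift_single (a : ℕ) (s w : M) :
    lift (fun n => if n = a then s else 1) w = s ^ occ a w := by
  induction w using FreeMonoid.inductionOn' with
  | one => simp
  | of_mul n w ih =>
    rw [map_mul, ih, lift_eval_of, occ_mul, occ_of, pow_add]
    split_ifs <;> simp

/-- Pairs identified by all homomorphisms into `ZMod 4` whose values satisfy `t ^ 2 = t ^ 3`. -/
def zmodCon : Con M where
  r u v := ∀ g : M →* ZMod 4, (∀ m, g m ^ 2 = g m ^ 3) → g u = g v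
  iseqv := ⟨fun _ _ _ => rfl, fun h g hg => (h g hg).symm,
    fun h h' g hg => (h g hg).trans (h' g hg)⟩
  mul' {_ _ _ _} h h' g hg := by rw [map_mul, map_mul, h g hg, h' g hg]

lemma thetaD_le_zmodCon : thetaD ≤ zmodCon := by
  refine sInf_le ⟨fun f u v h g hg => h (g.comp f) fun m => hg (f m), ?_⟩
  rintro p (rfl | rfl | rfl) g hg
  · simpa using hg x
  · simp only [map_mul, map_pow]; ring
  · simp only [map_mul, map_pow]; ring

lemma thetaD_le_capCon_two : thetaD ≤ capCon 2 := by
  intro u v h a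
  let g : M →* ZMod 4 := lift fun n => if n = a then 2 else 1
  have hg (w : M) : g w = 2 ^ occ a w := by
    induction w using FreeMonoid.inductionOn' with
    | one => simp
    | of_mul n w ih =>
      rw [map_mul, ih, occ_mul, occ_of, pow_add, lift_eval_of]
      split_ifs <;> simp
  have hpow (n : ℕ) : (2 : ZMod 4) ^ (n + 2) = 0 := by
    rw [pow_add, show (2 : ZMod 4) ^ 2 = 0 by decide, mul_zero]
  have key : (2 : ZMod 4) ^ occ a u = 2 ^ occ a v := by
    rw [← hg, ← hg]
    refine thetaD_le_zmodCon h g fun m => ?_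
    rw [hg]
    rcases occ a m with _ | n
    · simp
    · rw [← pow_mul, ← pow_mul, show (n + 1) * 2 = 2 * n + 2 by ring,
        show (n + 1) * 3 = (3 * n + 1) + 2 by ring, hpow, hpow]
  generalize occ a u = i at *
  generalize occ a v = j at *
  rcases i with _ | _ | i <;> rcases j with _ | _ | j <;>
    simp only [hpow, zero_add, pow_zero, pow_one] at key <;>
    first | omega | exact absurd key (by decide)

lemma fullyInvariant_thetaD : FullyInvariant thetaD := by
  intro f u v h c hc
  exact hc.1 f u v (h c hc)

lemma thetaD_of_mem {p : M × M}
    (hp : p ∈ ({(x ^ 2, x ^ 3), (x ^ 2 * y, x * y * x), (x * y * x, y * x ^ 2)} : Set (M × M))) :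
    thetaD p.1 p.2 := fun _ hc => hc.2 p hp

/-- The endomorphism used to evaluate an identity in `x` and `y`. -/
def substHom (s t : M) : M →* M := lift fun n => if n = 0 then s else t

lemma substHom_x (s t : M) : substHom s t x = s := by simp [substHom, x]

lemma substHom_y (s t : M) : substHom s t y = t := by simp [substHom, y]

lemma thetaD_sq_cube (s : M) : thetaD (s ^ 2) (s ^ 3) := by
  simpa [substHom_x] using fullyInvariant_thetaD (substHom s 1) _ _ (thetaD_of_mem (.inl rfl))

lemma thetaD_sq_mul (s t : M) : thetaD (s ^ 2 * t) (s * t * s) := by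
  simpa [substHom_x, substHom_y] using
    fullyInvariant_thetaD (substHom s t) _ _ (thetaD_of_mem (.inr (.inl rfl)))

lemma thetaD_mul_sq (s t : M) : thetaD (s * t * s) (t * s ^ 2) := by
  simpa [substHom_x, substHom_y] using
    fullyInvariant_thetaD (substHom s t) _ _ (thetaD_of_mem (.inr (.inr rfl)))

lemma mul_prod_filter_ne {Q : Type*} [Monoid Q] {e : Q} {g : ℕ → Q} {a : ℕ}
    (he : ∀ t, e * t = t * e) (ha : e * g a = e) (w : List ℕ) :
    e * (w.map g).prod = e * ((w.filter (· ≠ a)).map g).prod := by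
  induction w with
  | nil => simp
  | cons n w ih =>
    by_cases hn : n = a
    · subst hn
      rw [List.filter_cons_of_neg (by simp), List.map_cons, List.prod_cons, ← mul_assoc, ha, ih]
    · rw [List.filter_cons_of_pos (by simpa using hn), List.map_cons, List.map_cons,
        List.prod_cons, List.prod_cons, ← mul_assoc, he, mul_assoc, ih, ← mul_assoc, ← he,
        mul_assoc]

lemma quotient_sq_cube (s : thetaD.Quotient) : s ^ 2 = s ^ 3 := by
  induction s using Con.induction_on with
  | H s => exact (Con.eq thetaD).2 (thetaD_sq_cube s)

lemma quotient_sq_mul (s t : thetaD.Quotient) : s ^ 2 * t = s * t * s := by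
  induction s using Con.induction_on with
  | H s => induction t using Con.induction_on with
    | H t => exact (Con.eq thetaD).2 (thetaD_sq_mul s t)

lemma quotient_mul_sq (s t : thetaD.Quotient) : s * t * s = t * s ^ 2 := by
  induction s using Con.induction_on with
  | H s => induction t using Con.induction_on with
    | H t => exact (Con.eq thetaD).2 (thetaD_mul_sq s t)

lemma quotient_sq_comm (s t : thetaD.Quotient) : s ^ 2 * t = t * s ^ 2 :=
  (quotient_sq_mul s t).trans (quotient_mul_sq s t)

lemma quotient_sq_mul_self (s : thetaD.Quotient) : s ^ 2 * s = s ^ 2 := by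
  rw [← pow_succ, ← quotient_sq_cube]

lemma sq_mul_prod_of_two_le_count {g : ℕ → thetaD.Quotient} {a : ℕ} {w : List ℕ}
    (h : 2 ≤ w.count a) : (w.map g).prod = g a ^ 2 * (w.map g).prod := by
  obtain ⟨l₁, l₂, rfl⟩ := List.append_of_mem (List.count_pos_iff.1 (by omega : 0 < w.count a))
  have hw : ∀ p q r : thetaD.Quotient, p * (g a * (q * (g a * r))) =
      g a ^ 2 * (p * (g a * (q * (g a * r)))) := by
    intro p q r
    have : g a * (q * (g a * r)) = g a ^ 2 * (q * r) := by
      rw [← mul_assoc, ← mul_assoc, ← quotient_sq_mul, mul_assoc]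
    have hsq : g a ^ 2 * g a ^ 2 = g a ^ 2 := by
      rw [← pow_add, show 2 + 2 = 3 + 1 from rfl, pow_succ, ← quotient_sq_cube,
        quotient_sq_mul_self]
    rw [this, ← mul_assoc (g a ^ 2) p, quotient_sq_comm _ p, mul_assoc p,
      ← mul_assoc (g a ^ 2) (g a ^ 2), hsq]
  by_cases h₂ : a ∈ l₂
  · obtain ⟨l₃, l₄, rfl⟩ := List.append_of_mem h₂
    simpa using hw (l₁.map g).prod (l₃.map g).prod (l₄.map g).prod
  · have h₁ : a ∈ l₁ := by
      rw [← List.count_pos_iff]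
      rw [List.count_append, List.count_cons_self, List.count_eq_zero_of_not_mem h₂] at h
      omega
    obtain ⟨l₃, l₄, rfl⟩ := List.append_of_mem h₁
    simpa using hw (l₃.map g).prod (l₄.map g).prod (l₂.map g).prod

/-- Letters occurring at least twice can be collected into a central factor. -/
lemma exists_central_factor (g : ℕ → thetaD.Quotient) (S : Finset ℕ) :
    ∃ e : thetaD.Quotient, (∀ t, e * t = t * e) ∧ ∀ w : List ℕ, (∀ a ∈ S, 2 ≤ w.count a) →
      (w.map g).prod = e * ((w.filter (· ∉ S)).map g).prod := by
  induction S using Finset.induction_on with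
  | empty => exact ⟨1, by simp, by simp⟩
  | insert a S _ ih =>
    obtain ⟨e, he, h⟩ := ih
    refine ⟨g a ^ 2 * e, fun t => ?_, fun w hw => ?_⟩
    · rw [mul_assoc, he, ← mul_assoc, quotient_sq_comm, mul_assoc]
    · rw [sq_mul_prod_of_two_le_count (hw a (by simp)), h w fun b hb => hw b (by simp [hb]),
        ← mul_assoc, quotient_sq_comm, mul_assoc,
        mul_prod_filter_ne (quotient_sq_comm (g a)) (quotient_sq_mul_self (g a)),
        List.filter_filter, ← mul_assoc, ← quotient_sq_comm]
      simp

/-- Words that agree after deleting letters repeated in both are identified by `thetaD`. -/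
lemma thetaD_of_filter_eq {u v : M} (S : Finset ℕ) (hu : ∀ a ∈ S, 2 ≤ occ a u)
    (hv : ∀ a ∈ S, 2 ≤ occ a v)
    (h : u.toList.filter (· ∉ S) = v.toList.filter (· ∉ S)) : thetaD u v := by
  have hcoe (w : M) : (w : thetaD.Quotient) =
      (w.toList.map fun n => ((of n : M) : thetaD.Quotient)).prod := by
    induction w using FreeMonoid.inductionOn' with
    | one => simp
    | of_mul n w ih => simp [ih]
  obtain ⟨e, -, he⟩ := exists_central_factor (fun n => ((of n : M) : thetaD.Quotient)) S
  rw [← Con.eq, hcoe, hcoe, he _ hu, he _ hv, h]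

lemma thetaD_of_two_le_occ {u v : M} (hu : ∀ a, occ a u = 0 ∨ 2 ≤ occ a u)
    (hv : ∀ a, occ a v = 0 ∨ 2 ≤ occ a v) (h : ∀ a, occ a u = 0 ↔ occ a v = 0) :
    thetaD u v := by
  have hmem (w : M) (a : ℕ) : a ∈ w.toList.toFinset ↔ 0 < occ a w := by
    rw [List.mem_toFinset, mem_toList_iff]
  have hS : ∀ a, a ∈ u.toList.toFinset ↔ 0 < occ a v := fun a => by
    have := h a
    rw [hmem]
    omega
  refine thetaD_of_filter_eq u.toList.toFinset (fun a ha => ?_) (fun a ha => ?_) ?_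
  · have := hu a
    rw [hmem] at ha
    omega
  · have := hv a
    rw [hS] at ha
    omega
  · rw [List.filter_eq_nil_iff.2, List.filter_eq_nil_iff.2]
    · intro a ha
      simpa only [hS, decide_not, Bool.not_eq_true', Bool.not_eq_true, decide_eq_false_iff_not,
        not_not] using mem_toList_iff.1 ha
    · intro a ha
      simpa using ha

lemma eq_of_filter_pair_eq : ∀ {U V : List ℕ},
    (∀ a b, U.filter (fun n => n = a ∨ n = b) = V.filter (fun n => n = a ∨ n = b)) → U = V
  | [], [], _ => rfl
  | [], b :: V, h => by simpa using h b b
  | a :: U, [], h => by simpa using h a a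
  | a :: U, b :: V, h => by
    obtain rfl : a = b := by
      have := h a b
      rw [List.filter_cons_of_pos (by simp), List.filter_cons_of_pos (by simp)] at this
      exact (List.cons.inj this).1
    congr 1
    refine eq_of_filter_pair_eq fun c d => ?_
    have := h c d
    by_cases hp : a = c ∨ a = d
    · rw [List.filter_cons_of_pos (by simpa using hp),
        List.filter_cons_of_pos (by simpa using hp)] at this
      exact (List.cons.inj this).2
    · rwa [List.filter_cons_of_neg (by simpa using hp),
        List.filter_cons_of_neg (by simpa using hp)] at this

/-- Two distinct arrangements of at most two distinct letters are transposes of each other. -/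
lemma exists_swap_of_perm {U V : List ℕ} {a b : ℕ} (hU : U.Nodup)
    (hab : ∀ n ∈ U, n = a ∨ n = b) (hp : U.Perm V) (hne : U ≠ V) :
    ∃ p q, p ≠ q ∧ U = [p, q] ∧ V = [q, p] := by
  have hlen : U.length ≤ 2 := by
    rw [← List.toFinset_card_of_nodup hU]
    refine (Finset.card_le_card (t := {a, b}) fun n hn => ?_).trans Finset.card_le_two
    simpa using hab n (by simpa using hn)
  match U, V, hp.length_eq with
  | [], [], _ => exact absurd rfl hne
  | [p], [q], _ => simp_all
  | [p, q], [r, s], _ =>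
    have hr : r ∈ [p, q] := hp.mem_iff.2 (by simp)
    have hs : s ∈ [p, q] := hp.mem_iff.2 (by simp)
    have hV := hp.nodup hU
    simp only [List.nodup_cons, List.mem_cons, List.not_mem_nil, or_false] at hr hs hV hU
    refine ⟨p, q, by tauto, rfl, ?_⟩
    rcases hr with rfl | rfl <;> rcases hs with rfl | rfl <;> simp_all
  | _ :: _ :: _ :: _, _, _ => simp at hlen

lemma lift_filter (p : ℕ → Prop) [DecidablePred p] (w : M) :
    lift (fun n => if p n then of n else 1) w = ofList (w.toList.filter p) := by
  induction w using FreeMonoid.inductionOn' with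
  | one => simp
  | of_mul n w ih =>
    rw [map_mul, ih, lift_eval_of]
    by_cases hn : p n <;> simp [hn, ofList_cons]

/-- The letters occurring at least twice in a word. -/
def repeated (w : M) : Finset ℕ := w.toList.toFinset.filter fun a => 2 ≤ occ a w

lemma mem_repeated {a : ℕ} {w : M} : a ∈ repeated w ↔ 2 ≤ occ a w := by
  rw [repeated, Finset.mem_filter, List.mem_toFinset, mem_toList_iff]
  omega

/-- A congruence that preserves capped occurrence numbers either lies below `thetaD` or reorders
two letters occurring once, hence is commutative. -/
lemma le_thetaD_or_comm {b : Con M} (hb : FullyInvariant b) (hcap : b ≤ capCon 2) :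
    b ≤ thetaD ∨ ∀ s t, b (s * t) (t * s) := by
  by_contra! h
  obtain ⟨hθ, s, t, hst⟩ := h
  refine hθ fun u v huv => ?_
  have hocc := hcap huv
  refine thetaD_of_filter_eq (repeated u) (fun a ha => mem_repeated.1 ha) (fun a ha => ?_) ?_
  · have := hocc a
    rw [mem_repeated] at ha
    omega
  refine eq_of_filter_pair_eq fun c d => ?_
  by_contra hne
  rw [List.filter_filter, List.filter_filter] at hne
  have hcount (w : M) (n : ℕ) (P : ℕ → Bool) :
      (w.toList.filter P).count n = if P n then occ n w else 0 := by
    split_ifs with hn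
    · exact List.count_filter hn
    · exact List.count_eq_zero_of_not_mem (by simp [hn])
  have hnot {n : ℕ} {P : Prop} [Decidable P] (hn : (decide P && decide (n ∉ repeated u)) = true) :
      occ n u < 2 := by
    simp only [Bool.and_eq_true, decide_eq_true_eq, mem_repeated] at hn
    omega
  obtain ⟨p, q, hpq, hu, hv⟩ : ∃ p q, p ≠ q ∧ _ = [p, q] ∧ _ = [q, p] := by
    refine exists_swap_of_perm (a := c) (b := d) (List.nodup_iff_count_le_one.2 fun n => ?_)
      (fun n hn => ?_) (List.perm_iff_count.2 fun n => ?_) hne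
    · rw [hcount]
      split_ifs with hn
      · exact Nat.le_of_lt_succ (hnot hn)
      · omega
    · simp only [List.mem_filter, Bool.and_eq_true, decide_eq_true_eq] at hn
      exact hn.2.1
    · rw [hcount, hcount]
      split_ifs with hn
      · have := hnot hn
        have := hocc n
        omega
      · rfl
  have key := hb (lift fun n => if (n = c ∨ n = d) ∧ n ∉ repeated u then of n else 1) u v huv
  rw [lift_filter, lift_filter] at key
  simp only [Bool.decide_and] at key
  rw [hu, hv] at key
  have := hb (lift fun n => if n = p then s else t) _ _ key
  apply hst
  simpa [ofList_cons, hpq.symm] using this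

lemma con_of_perm {b : Con M} (hcomm : ∀ s t, b (s * t) (t * s)) {U V : List ℕ}
    (h : U.Perm V) : b (ofList U) (ofList V) := by
  induction h with
  | nil => exact b.refl _
  | cons n _ ih => exact b.mul (b.refl (of n)) ih
  | swap m n l =>
    simpa only [ofList_cons, mul_assoc] using b.mul (hcomm (of n) (of m)) (b.refl (ofList l))
  | trans _ _ ih ih' => exact b.trans ih ih'

/-- A congruence that does not preserve content contains an identity `1 ≈ s ^ k`. -/
lemma exists_one_pow {b : Con M} (hb : FullyInvariant b) (h : ¬ b ≤ capCon 1) :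
    ∃ k, 1 ≤ k ∧ ∀ s, b 1 (s ^ k) := by
  simp only [Con.le_def, capCon_apply, not_forall] at h
  obtain ⟨u, v, huv, a, ha⟩ := h
  have key (s : M) := hb (lift fun n => if n = a then s else 1) u v huv
  simp only [lift_single] at key
  rcases Nat.eq_zero_or_pos (occ a u) with h0 | h0
  · exact ⟨occ a v, by omega, fun s => by simpa [h0] using key s⟩
  · have h1 : occ a v = 0 := by omega
    exact ⟨occ a u, h0, fun s => b.symm (by simpa [h1] using key s)⟩

/-- A congruence that preserves content but not the set of letters occurring once contains an
identity `s ≈ s ^ k`. -/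
lemma exists_self_pow {b : Con M} (hb : FullyInvariant b) (h₁ : b ≤ capCon 1)
    (h : ¬ b ≤ capCon 2) : ∃ k, 2 ≤ k ∧ ∀ s, b s (s ^ k) := by
  simp only [Con.le_def, capCon_apply, not_forall] at h
  obtain ⟨u, v, huv, a, ha⟩ := h
  have h₁a := h₁ huv a
  have key (s : M) := hb (lift fun n => if n = a then s else 1) u v huv
  simp only [lift_single] at key
  rcases Nat.lt_or_ge (occ a u) 2 with h0 | h0
  · have h0 : occ a u = 1 := by omega
    exact ⟨occ a v, by omega, fun s => by simpa [h0] using key s⟩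
  · have h1 : occ a v = 1 := by omega
    exact ⟨occ a u, h0, fun s => b.symm (by simpa [h1] using key s)⟩

/-- The join `thetaD ⊔ b` is the composition `b ∘ thetaD ∘ b`. -/
lemma exists_of_sup {b : Con M} (hb : FullyInvariant b) {u v : M} (h : (thetaD ⊔ b) u v) :
    ∃ u' v', b u u' ∧ thetaD u' v' ∧ b v' v := by
  by_cases h₁ : b ≤ capCon 1
  swap
  · obtain ⟨k, hk, hpow⟩ := exists_one_pow hb h₁
    let e := u ^ k * u ^ k * (v ^ k * v ^ k)
    have he : b 1 e := by
      simpa using b.mul (b.mul (hpow u) (hpow u)) (b.mul (hpow v) (hpow v))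
    have hocc (a : ℕ) : occ a e = 2 * (k * occ a u) + 2 * (k * occ a v) := by
      simp only [e, occ_mul, occ_pow]
      ring
    have hle (a : ℕ) (w : M) : occ a w ≤ k * occ a w := Nat.le_mul_of_pos_left _ hk
    have hzero (a : ℕ) (w : M) (hw : occ a w = 0) : k * occ a w = 0 := by simp [hw]
    refine ⟨e * u, e * v, by simpa using b.mul he (b.refl u), ?_,
      b.symm (by simpa using b.mul he (b.refl v))⟩
    apply thetaD_of_two_le_occ <;> intro a <;> simp only [occ_mul, hocc] <;>
      have := hle a u <;> have := hle a v <;> have := hzero a u <;> have := hzero a v <;> omega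
  by_cases h₂ : b ≤ capCon 2
  swap
  · obtain ⟨k, hk, hpow⟩ := exists_self_pow hb h₁ h₂
    have hsup := sup_le (thetaD_le_capCon_two.trans capCon_two_le_one) h₁ h
    let f : M →* M := lift fun n => of n ^ k
    have hf (w : M) : b w (f w) := by
      induction w using FreeMonoid.inductionOn' with
      | one => simpa using b.refl 1
      | of_mul n w ih =>
        rw [map_mul f]
        exact b.mul (by simpa [f] using hpow (of n)) ih
    have hocc (a : ℕ) (w : M) : occ a (f w) = k * occ a w := by
      induction w using FreeMonoid.inductionOn' with
      | one => simp
      | of_mul n w ih =>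
        rw [map_mul, occ_mul, ih, occ_mul, mul_add]
        simp [f]
    have htwo (a : ℕ) (w : M) : occ a (f w) = 0 ∨ 2 ≤ occ a (f w) := by
      rw [hocc]
      rcases Nat.eq_zero_or_pos (occ a w) with h0 | h0
      · simp [h0]
      · exact .inr (hk.trans (Nat.le_mul_of_pos_right _ h0))
    refine ⟨f u, f v, hf u, thetaD_of_two_le_occ (htwo · u) (htwo · v) fun a => ?_, b.symm (hf v)⟩
    have := hsup a
    rw [hocc, hocc, mul_eq_zero, mul_eq_zero]
    omega
  rcases le_thetaD_or_comm hb h₂ with hθ | hcomm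
  · rw [sup_eq_left.2 hθ] at h
    exact ⟨u, v, b.refl u, h, b.refl v⟩
  have hsup := sup_le thetaD_le_capCon_two h₂ h
  let S := repeated u
  let V := v.toList.filter (· ∈ S) ++ u.toList.filter (· ∉ S)
  have hperm : V.Perm v.toList := by
    refine List.Perm.trans (List.Perm.append_left _ ?_) (List.filter_append_perm (· ∈ S) v.toList)
    simp only [← decide_not]
    refine List.perm_iff_count.2 fun n => ?_
    by_cases hn : n ∈ S
    · rw [List.count_eq_zero_of_not_mem (by simp [hn]), List.count_eq_zero_of_not_mem (by simp [hn])]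
    · rw [List.count_filter (by simpa using hn), List.count_filter (by simpa using hn)]
      have h' := hsup n
      rw [mem_repeated] at hn
      change occ n u = occ n v
      omega
  refine ⟨u, ofList V, b.refl u, thetaD_of_filter_eq S (fun a ha => mem_repeated.1 ha)
    (fun a ha => ?_) ?_, by simpa using con_of_perm hcomm hperm⟩
  · have h' := hsup a
    rw [mem_repeated] at ha
    rw [occ, toList_ofList, hperm.count_eq]
    change 2 ≤ occ a v
    omega
  · rw [toList_ofList, List.filter_append, List.filter_filter, List.filter_filter]
    simp

end ThetaD

/-- `θ_D` is a modular element of the lattice of fully invariant congruences on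
the free monoid. (Dual rendering of: the variety `D = var{x² ≈ x³,
x²y ≈ xyx ≈ yx²}` is a modular element of 𝕄𝕆ℕ.) -/
theorem thetaD_is_modular :
    ∀ b c : Con M, FullyInvariant b → FullyInvariant c → b ≤ c →
      (thetaD ⊔ b) ⊓ c = (thetaD ⊓ c) ⊔ b := by
  intro b c hb _ hbc
  refine le_antisymm ?_ (sup_le (inf_le_inf_right c le_sup_left) (le_inf le_sup_right hbc))
  rintro u v ⟨h, huv⟩
  obtain ⟨u', v', hu, hθ, hv⟩ := ThetaD.exists_of_sup hb h
  have hc : c u' v' := c.trans (c.symm (hbc hu)) (c.trans huv (c.symm (hbc hv)))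
  have hmid : (thetaD ⊓ c) u' v' := ⟨hθ, hc⟩
  have hle : b ≤ (thetaD ⊓ c) ⊔ b := le_sup_right
  exact Con.trans _ (hle hu) (Con.trans _ ((le_sup_left : thetaD ⊓ c ≤ _) hmid) (hle hv))
end

section
/- For all u, v in the free monoid M = FreeMonoid ℕ, the congruence θ_SL relates u and v if and only if u and v contain the same set of letters, i.e., {i : ℕ | FreeMonoid.of i occurs in u} = {i : ℕ | FreeMonoid.of i occurs in v}. (This is the solution of the word problem for the variety SL of semilattice monoids, used throughout the paper.) -/
/-- `θ_SL`, the least fully invariant congruence containing the pairs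
`(x*x, x)` and `(x*y, y*x)`. -/
def thetaSL : Con M := fiClosure {(x * x, x), (x * y, y * x)}

/-- The letters of the image of a word under an endomorphism are the letters of the images of
its letters. -/
theorem mem_map_hom_iff (f : M →* M) (u : M) (i : ℕ) :
    i ∈ f u ↔ ∃ j ∈ u, i ∈ f (FreeMonoid.of j) := by
  induction u using FreeMonoid.inductionOn' with
  | one => simp [FreeMonoid.notMem_one]
  | of_mul a w ih => simp [FreeMonoid.mem_mul, FreeMonoid.mem_of, ih]

/-- The congruence relating two words when they have the same letters. -/
def contentCon : Con M where
  r u v := ∀ i, i ∈ u ↔ i ∈ v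
  iseqv := ⟨fun _ _ => Iff.rfl, fun h i => (h i).symm, fun h k i => (h i).trans (k i)⟩
  mul' h k i := by simp only [FreeMonoid.mem_mul, h i, k i]

theorem fullyInvariant_contentCon : FullyInvariant contentCon := by
  intro f u v h i
  rw [mem_map_hom_iff f u, mem_map_hom_iff f v]
  exact exists_congr fun j => and_congr_left' (h j)

theorem thetaSL_le_contentCon : thetaSL ≤ contentCon := by
  refine sInf_le ⟨fullyInvariant_contentCon, ?_⟩
  rintro p (rfl | rfl) i
  · exact FreeMonoid.mem_mul.trans (or_self_iff)
  · exact FreeMonoid.mem_mul.trans (or_comm.trans FreeMonoid.mem_mul.symm)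

theorem fullyInvariant_fiClosure (S : Set (M × M)) : FullyInvariant (fiClosure S) :=
  fun f u v h c hc => hc.1 f u v (h c hc)

theorem fiClosure_of_mem {S : Set (M × M)} {p : M × M} (hp : p ∈ S) : fiClosure S p.1 p.2 :=
  fun _ hc => hc.2 p hp

theorem thetaSL_mul_self (a : M) : thetaSL (a * a) a := by
  have h : thetaSL _ _ := fullyInvariant_fiClosure _ (FreeMonoid.lift fun _ => a) _ _
    (fiClosure_of_mem (S := {(x * x, x), (x * y, y * x)}) (p := (x * x, x)) (by simp))
  simpa [x] using h

theorem thetaSL_mul_comm (a b : M) : thetaSL (a * b) (b * a) := by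
  have h : thetaSL _ _ := fullyInvariant_fiClosure _ (FreeMonoid.lift fun n => if n = 0 then a else b) _ _
    (fiClosure_of_mem (S := {(x * x, x), (x * y, y * x)}) (p := (x * y, y * x)) (by simp))
  simpa [x, y] using h

theorem thetaSL_mul_of_mem {u : M} {i : ℕ} (h : i ∈ u) : thetaSL (u * FreeMonoid.of i) u := by
  obtain ⟨s, t, rfl⟩ : ∃ s t : M, u = s * (FreeMonoid.of i * t) := List.append_of_mem h
  have key : thetaSL (FreeMonoid.of i * t * FreeMonoid.of i) (FreeMonoid.of i * t) := by
    refine thetaSL.trans (thetaSL_mul_comm _ _) ?_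
    rw [← mul_assoc]
    exact thetaSL.mul (thetaSL_mul_self _) (thetaSL.refl t)
  rw [mul_assoc]
  exact thetaSL.mul (thetaSL.refl s) key

theorem thetaSL_mul_of_forall_mem {u v : M} (h : ∀ i ∈ v, i ∈ u) : thetaSL (u * v) u := by
  induction v using FreeMonoid.inductionOn' with
  | one => simpa using thetaSL.refl u
  | of_mul a w ih =>
    simp only [FreeMonoid.mem_mul, FreeMonoid.mem_of] at h
    rw [← mul_assoc]
    exact thetaSL.trans (thetaSL.mul (thetaSL_mul_of_mem (h a (.inl rfl))) (thetaSL.refl w))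
      (ih fun i hi => h i (.inr hi))

/-- The word problem for the variety of semilattice monoids: `θ_SL` relates two
words if and only if they contain the same set of letters. -/
theorem thetaSL_word_problem (u v : M) :
    thetaSL u v ↔
      {i : ℕ | i ∈ FreeMonoid.toList u} = {i : ℕ | i ∈ FreeMonoid.toList v} := by
  rw [Set.ext_iff]
  refine ⟨fun h => thetaSL_le_contentCon h, fun h => ?_⟩
  exact thetaSL.trans (thetaSL.symm (thetaSL_mul_of_forall_mem fun i hi => (h i).2 hi))
    (thetaSL.trans (thetaSL_mul_comm u v) (thetaSL_mul_of_forall_mem fun i hi => (h i).1 hi))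
end

section
/- Let n ≥ 2. For all u, v in the free monoid M = FreeMonoid ℕ, the congruence θ_{C_n} relates u and v if and only if for every letter i : ℕ, min(n, the number of occurrences of i in u) = min(n, the number of occurrences of i in v). (This is the solution of the word problem for the variety C_n = var{x^n ≈ x^(n+1), xy ≈ yx}, used implicitly throughout the paper.) -/
/-- `θ_{C_n}`, the least fully invariant congruence containing
`(x^n, x^(n+1))` and `(x*y, y*x)`. -/
def thetaC (n : ℕ) : Con M := fiClosure {(x ^ n, x ^ (n + 1)), (x * y, y * x)}

theorem fiClosure_iff (S : Set (M × M)) (u v : M) :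
    fiClosure S u v ↔ ∀ c : Con M, FullyInvariant c → (∀ p ∈ S, c p.1 p.2) → c u v :=
  ⟨fun h c hc hS => h c ⟨hc, hS⟩, fun h c hc => h c hc.1 hc.2⟩

theorem fiClosure_of_mem_s9 {S : Set (M × M)} {u v : M} (h : (u, v) ∈ S) : fiClosure S u v :=
  (fiClosure_iff S u v).2 fun _ _ hS => hS _ h

theorem fullyInvariant_thetaC (n : ℕ) : FullyInvariant (thetaC n) :=
  fullyInvariant_fiClosure _

theorem thetaC_pow (n : ℕ) (a : M) : thetaC n (a ^ n) (a ^ (n + 1)) := by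
  have h : thetaC n (x ^ n) (x ^ (n + 1)) := fiClosure_of_mem_s9 (Set.mem_insert _ _)
  simpa [x] using fullyInvariant_thetaC n (FreeMonoid.lift fun _ => a) _ _ h

theorem thetaC_mul_comm (n : ℕ) (a b : M) : thetaC n (a * b) (b * a) := by
  have h : thetaC n (x * y) (y * x) := fiClosure_of_mem_s9 (Set.mem_insert_of_mem _ rfl)
  simpa [x, y] using
    fullyInvariant_thetaC n (FreeMonoid.lift fun i => if i = 0 then a else b) _ _ h

/-- Two words are related when every additive weight on letters gives them the same total
weight after truncation at `n`. -/
def truncatedWeightCon (n : ℕ) : Con M where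
  r u v := ∀ φ : M →* Multiplicative ℕ, min n (φ u).toAdd = min n (φ v).toAdd
  iseqv := ⟨fun _ _ => rfl, fun h φ => (h φ).symm, fun h₁ h₂ φ => (h₁ φ).trans (h₂ φ)⟩
  mul' h₁ h₂ φ := by
    have := h₁ φ
    have := h₂ φ
    simp only [map_mul, toAdd_mul]
    omega

theorem fullyInvariant_truncatedWeightCon (n : ℕ) : FullyInvariant (truncatedWeightCon n) :=
  fun f _ _ h φ => h (φ.comp f)

theorem thetaC_le_truncatedWeightCon (n : ℕ) : thetaC n ≤ truncatedWeightCon n := by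
  refine sInf_le ⟨fullyInvariant_truncatedWeightCon n, ?_⟩
  rintro p (rfl | rfl) φ
  · simp only [map_pow, toAdd_pow, smul_eq_mul]
    rcases Nat.eq_zero_or_pos (φ x).toAdd with h | h
    · simp [h]
    · rw [min_eq_left (Nat.le_mul_of_pos_right n h),
        min_eq_left ((Nat.le_succ n).trans (Nat.le_mul_of_pos_right (n + 1) h))]
  · simp only [map_mul, mul_comm]

theorem pow_min_eq_of_pow_eq_pow_succ {Q : Type*} [Monoid Q] {n : ℕ} {q : Q}
    (h : q ^ n = q ^ (n + 1)) (k : ℕ) : q ^ min n k = q ^ k := by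
  rcases le_total k n with hk | hk
  · rw [min_eq_right hk]
  · rw [min_eq_left hk]
    induction k, hk using Nat.le_induction with
    | base => rfl
    | succ k _ ih => rw [pow_succ, ← ih, ← pow_succ, h]

theorem map_eq_of_min_count_eq {Q : Type*} [CommMonoid Q] {n : ℕ} (hn : n ≠ 0)
    (hQ : ∀ q : Q, q ^ n = q ^ (n + 1)) (φ : M →* Q) {u v : M}
    (h : ∀ i : ℕ, min n ((FreeMonoid.toList u).count i)
      = min n ((FreeMonoid.toList v).count i)) : φ u = φ v := by
  have hφ (w : M) : φ w = ∏ i ∈ (FreeMonoid.toList w).toFinset,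
      φ (FreeMonoid.of i) ^ (FreeMonoid.toList w).count i := by
    rw [← Finset.prod_list_map_count, ← Function.comp_def, ← FreeMonoid.lift_apply]
    exact congrArg (· w) (FreeMonoid.lift_restrict φ).symm
  have hs : (FreeMonoid.toList u).toFinset = (FreeMonoid.toList v).toFinset := by
    ext i
    have := h i
    rw [List.mem_toFinset, List.mem_toFinset, ← List.count_pos_iff, ← List.count_pos_iff]
    omega
  rw [hφ u, hφ v, hs]
  refine Finset.prod_congr rfl fun i _ => ?_
  rw [← pow_min_eq_of_pow_eq_pow_succ (hQ _), h i, pow_min_eq_of_pow_eq_pow_succ (hQ _)]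

/-- The word problem for the variety `C_n = var{x^n ≈ x^(n+1), xy ≈ yx}`
(`n ≥ 2`): `θ_{C_n}` relates two words if and only if, for every letter, the
numbers of occurrences of that letter in the two words agree after truncation
at `n`. -/
theorem thetaC_word_problem (n : ℕ) (hn : 2 ≤ n) (u v : M) :
    thetaC n u v ↔
      ∀ i : ℕ, min n ((FreeMonoid.toList u).count i)
        = min n ((FreeMonoid.toList v).count i) := by
  constructor
  · intro h i
    exact thetaC_le_truncatedWeightCon n h (FreeMonoid.count i)
  · intro h
    let _ : CommMonoid (thetaC n).Quotient :=
      { (inferInstance : Monoid (thetaC n).Quotient) with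
        mul_comm := fun a b => Con.induction_on₂ a b fun a b =>
          (Con.eq _).2 (thetaC_mul_comm n a b) }
    refine (Con.eq _).1 (map_eq_of_min_count_eq (by omega) (fun q => ?_) (thetaC n).mk' h)
    exact Con.induction_on q fun a => (Con.eq _).2 (thetaC_pow n a)
end

section
/- Let r ≥ 2, s ≥ 1, t ≥ 0 with s + t ≥ 2. Then the congruence θ_LRB does not relate y^2*x^r and x^s*y^2*x^t. (This renders the paper's claim that the variety LRB = var{xy ≈ xyx} violates the identity y²x^r ≈ x^s y² x^t, which is proved there via the identities y²x^r ≈ yx and x^s y² x^t ≈ xy valid in LRB and the fact that xy ≈ yx fails in LRB.) -/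
/-- `θ_LRB`, the least fully invariant congruence containing the pair
`(x*y, x*y*x)`. -/
def thetaLRB : Con M := fiClosure {(x * y, x * y * x)}

/-- Soundness of `thetaLRB` for left regular band monoids: `thetaLRB` is contained
in the kernel of every homomorphism to a monoid satisfying `a * b = a * b * a`. -/
theorem map_eq_of_thetaLRB {N : Type*} [Monoid N] (hN : ∀ a b : N, a * b = a * b * a)
    (g : M →* N) {u v : M} (h : thetaLRB u v) : g u = g v := by
  let c : Con M := sInf (Set.range fun k : M →* N => Con.ker k)
  have hc : ∀ {u v : M}, c u v ↔ ∀ k : M →* N, k u = k v :=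
    Set.forall_mem_range
  have hmem : c ∈ {c : Con M | FullyInvariant c ∧ ∀ p ∈ ({(x * y, x * y * x)} : Set (M × M)),
      c p.1 p.2} := by
    refine ⟨fun f u v huv => hc.2 fun k => hc.1 huv (k.comp f), ?_⟩
    rintro p rfl
    exact hc.2 fun k => by simpa using hN (k x) (k y)
  exact hc.1 (sInf_le hmem h) g

/-- The left zero semigroup on `α` with an identity element `none` adjoined. -/
def LeftZeroWithOne (α : Type*) : Type _ := Option α

namespace LeftZeroWithOne

variable {α : Type*}

instance : Monoid (LeftZeroWithOne α) where
  mul := Option.or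
  one := none
  mul_assoc _ _ _ := Option.or_assoc
  one_mul _ := Option.none_or
  mul_one _ := Option.or_none

/-- The inclusion of the left zero semigroup. -/
def of (a : α) : LeftZeroWithOne α := some a

theorem of_injective : Function.Injective (of : α → LeftZeroWithOne α) :=
  Option.some_injective α

theorem of_mul (a : α) (b : LeftZeroWithOne α) : of a * b = of a := rfl

theorem mul_eq_mul_mul_self (a b : LeftZeroWithOne α) : a * b = a * b * a := by
  rcases a with _ | a
  · exact (mul_one _).symm
  · rfl

theorem of_pow (a : α) {n : ℕ} (hn : n ≠ 0) : of a ^ n = of a := by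
  obtain ⟨n, rfl⟩ := Nat.exists_eq_succ_of_ne_zero hn
  rw [pow_succ', of_mul]

end LeftZeroWithOne

/-- The variety `LRB = var{xy ≈ xyx}` violates the identity
`y² x^r ≈ x^s y² x^t` whenever `r ≥ 2`, `s ≥ 1` and `s + t ≥ 2`: the congruence
`θ_LRB` does not relate `y^2*x^r` and `x^s*y^2*x^t`. -/
theorem thetaLRB_not_relates (r s t : ℕ) (hr : 2 ≤ r) (hs : 1 ≤ s)
    (hst : 2 ≤ s + t) :
    ¬ thetaLRB (y ^ 2 * x ^ r) (x ^ s * y ^ 2 * x ^ t) := by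
  intro h
  have key := map_eq_of_thetaLRB LeftZeroWithOne.mul_eq_mul_mul_self
    (FreeMonoid.lift (LeftZeroWithOne.of : ℕ → LeftZeroWithOne ℕ)) h
  have hs' : s ≠ 0 := by omega
  simp only [x, y, map_mul, map_pow, FreeMonoid.lift_eval_of, LeftZeroWithOne.of_mul,
    LeftZeroWithOne.of_pow _ hs', LeftZeroWithOne.of_pow _ two_ne_zero] at key
  exact one_ne_zero (LeftZeroWithOne.of_injective key)
end

section
/- Let n ≥ 2 and let c be a fully invariant congruence on the free monoid M = FreeMonoid ℕ with c ≤ θ_E. If the congruence c ⊓ θ_{C_{n+1}} relates y*x^n and a word w, then w = y*x^n. (This renders the paper's claim that the word y x^n is an isoterm for the variety V ∨ C_{n+1} whenever V contains E: that join satisfies no non-trivial identity of the form y x^n ≈ w.) -/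
/-- `θ_E`, the least fully invariant congruence containing `(x^2, x^3)`,
`(x^2*y, x*y*x)` and `(x^2*y^2, y^2*x^2)`. -/
def thetaE : Con M :=
  fiClosure {(x ^ 2, x ^ 3), (x ^ 2 * y, x * y * x), (x ^ 2 * y ^ 2, y ^ 2 * x ^ 2)}

/-- A fully invariant congruence containing the generating pairs contains their closure. -/
theorem fiClosure_le {S : Set (M × M)} {c : Con M} (hc : FullyInvariant c)
    (hS : ∀ p ∈ S, c p.1 p.2) : fiClosure S ≤ c :=
  sInf_le ⟨hc, hS⟩

/-- The identities satisfied by a monoid `N`, as a congruence on the free monoid. -/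
def identitiesOf (N : Type) [Monoid N] : Con M where
  r u v := ∀ φ : M →* N, φ u = φ v
  iseqv := ⟨fun _ _ => rfl, fun h φ => (h φ).symm, fun h k φ => (h φ).trans (k φ)⟩
  mul' h k φ := by rw [map_mul, map_mul, h φ, k φ]

theorem fullyInvariant_identitiesOf (N : Type) [Monoid N] : FullyInvariant (identitiesOf N) :=
  fun f _ _ h φ => h (φ.comp f)

/-- The identities satisfied by the additive monoid of natural numbers truncated at `m`. -/
def truncatedIdentities (m : ℕ) : Con M where
  r u v := ∀ φ : M →* Multiplicative ℕ, min (φ u).toAdd m = min (φ v).toAdd m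
  iseqv := ⟨fun _ _ => rfl, fun h φ => (h φ).symm, fun h k φ => (h φ).trans (k φ)⟩
  mul' h k φ := by
    have h := h φ
    have k := k φ
    simp only [map_mul, toAdd_mul]
    omega

theorem thetaC_le_truncatedIdentities (m : ℕ) : thetaC m ≤ truncatedIdentities m := by
  refine fiClosure_le (fun f _ _ h φ => h (φ.comp f)) ?_
  rintro p (rfl | rfl) φ
  · simp only [map_pow, toAdd_pow, smul_eq_mul]
    rcases Nat.eq_zero_or_pos (φ x).toAdd with h | h
    · simp [h]
    · have := Nat.le_mul_of_pos_right m h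
      rw [add_mul]
      omega
  · simp [mul_comm]

theorem count_eq_of_thetaC {m : ℕ} {u v : M} (h : thetaC m u v) (a : ℕ)
    (hu : List.count a u.toList < m) : List.count a v.toList = List.count a u.toList := by
  have : min (List.count a u.toList) m = min (List.count a v.toList) m :=
    thetaC_le_truncatedIdentities m h (FreeMonoid.count a)
  omega

/-- The monoid with zero generated by `a` and `b` subject to
`a ^ 2 = a`, `b ^ 2 = b * a * b = 0` and `a * b * a = a * b`. -/
inductive OrderMonoid
  | one | a | b | ab | ba | zero
  deriving DecidableEq

namespace OrderMonoid

instance : Fintype OrderMonoid where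
  elems := {one, a, b, ab, ba, zero}
  complete s := by cases s <;> decide

/-- The multiplication table of `OrderMonoid`. -/
def mul : OrderMonoid → OrderMonoid → OrderMonoid
  | one, t => t
  | s, one => s
  | a, a => a
  | a, b => ab
  | a, ab => ab
  | a, ba => ab
  | b, a => ba
  | ab, a => ab
  | ba, a => ba
  | _, _ => zero

instance : Monoid OrderMonoid where
  mul := mul
  one := one
  mul_assoc := by decide
  one_mul := by decide
  mul_one := by decide

theorem pow_two_eq_pow_three (s : OrderMonoid) : s ^ 2 = s ^ 3 := by
  simp only [pow_succ, pow_zero]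
  revert s
  decide

theorem pow_two_mul (s t : OrderMonoid) : s ^ 2 * t = s * t * s := by
  rw [pow_two]
  revert s t
  decide

theorem pow_two_mul_pow_two_comm (s t : OrderMonoid) : s ^ 2 * t ^ 2 = t ^ 2 * s ^ 2 := by
  rw [pow_two, pow_two]
  revert s t
  decide

theorem a_pow {n : ℕ} (hn : n ≠ 0) : a ^ n = a :=
  (show IsIdempotentElem a from rfl).pow_eq hn

/-- The evaluation of words sending the first two letters to `a` and `b`, and
every other letter to `1`. -/
def eval : M →* OrderMonoid :=
  FreeMonoid.lift fun i => if i = 0 then a else if i = 1 then b else 1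

end OrderMonoid

theorem thetaE_le_identitiesOf_orderMonoid : thetaE ≤ identitiesOf OrderMonoid := by
  refine fiClosure_le (fullyInvariant_identitiesOf _) ?_
  rintro p (rfl | rfl | rfl) φ
  · simpa using OrderMonoid.pow_two_eq_pow_three (φ x)
  · simpa using OrderMonoid.pow_two_mul (φ x) (φ y)
  · simpa using OrderMonoid.pow_two_mul_pow_two_comm (φ x) (φ y)

theorem toList_y_mul_x_pow (n : ℕ) : (y * x ^ n).toList = 1 :: List.replicate n 0 := by
  have h : (x ^ n).toList = List.replicate n 0 := by
    induction n with
    | zero => rfl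
    | succ k ih => rw [pow_succ', FreeMonoid.toList_mul, ih]; rfl
  rw [FreeMonoid.toList_mul, h]
  rfl

/-- The word `y x^n` is an isoterm for `V ∨ C_{n+1}` whenever `V ⊇ E` (dual
rendering): if `n ≥ 2` and `c` is a fully invariant congruence with `c ≤ θ_E`,
then the only word related to `y*x^n` by `c ⊓ θ_{C_{n+1}}` is `y*x^n` itself. -/
theorem yxn_isoterm (n : ℕ) (hn : 2 ≤ n) (c : Con M) (hc : FullyInvariant c)
    (hcE : c ≤ thetaE) :
    ∀ w : M, (c ⊓ thetaC (n + 1)) (y * x ^ n) w → w = y * x ^ n := by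
  rintro w ⟨h_c, h_count⟩
  have h_eval : OrderMonoid.eval w = OrderMonoid.ba := by
    rw [← thetaE_le_identitiesOf_orderMonoid (hcE h_c) OrderMonoid.eval, map_mul, map_pow]
    change OrderMonoid.b * OrderMonoid.a ^ n = _
    rw [OrderMonoid.a_pow (by omega)]
    rfl
  have h_letter (a : ℕ) :
      List.count a w.toList = List.count a (1 :: List.replicate n 0) := by
    rw [← toList_y_mul_x_pow]
    refine count_eq_of_thetaC h_count a ?_
    rw [toList_y_mul_x_pow, List.count_cons, List.count_replicate]
    grind
  apply FreeMonoid.toList.injective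
  rw [toList_y_mul_x_pow]
  induction w using FreeMonoid.casesOn with
  | one => exact absurd (h_letter 1) (by simp)
  | of_mul i v =>
    rw [FreeMonoid.toList_mul, FreeMonoid.toList_of, List.singleton_append] at h_letter ⊢
    have h_mem (j : ℕ) (hj : j ∈ i :: v.toList) : j = 0 ∨ j = 1 := by
      have := List.count_pos_iff.2 hj
      rw [h_letter, List.count_pos_iff] at this
      grind
    have h_head : i = 1 := by
      refine (h_mem i (by simp)).resolve_left ?_
      rintro rfl
      rw [map_mul] at h_eval
      change OrderMonoid.a * OrderMonoid.eval v = _ at h_eval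
      generalize OrderMonoid.eval v = s at h_eval
      revert s
      decide
    subst h_head
    have h_one : 1 ∉ v.toList := by
      have := h_letter 1
      rw [← List.count_eq_zero]
      simpa [List.count_replicate] using this
    have h_zero : ∀ j ∈ v.toList, j = 0 := fun j hj =>
      (h_mem j (by simp [hj])).resolve_right fun h => h_one (h ▸ hj)
    have h_length : v.toList.length = n := by
      rw [← List.count_eq_length.2 fun j hj => (h_zero j hj).symm]
      simpa using h_letter 0
    rw [List.eq_replicate_iff.2 ⟨h_length, h_zero⟩]
end
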